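/- For every irrational x ∈ (0,1), the series ∑_{k=0}^∞ ( 4·(−1)^k·β_{k−1}(x)^2·β_k(x)·γ_k(x)·∑_{j=0}^{k−1} (−1)^j·T^j(x)/β_j(x)^2 − β_{k−1}(x)^2 ) converges absolutely. -/

import Mathlib

open Real

noncomputable section

/-- The Gauss map: `T 0 = 0` and `T y = 1/y mod 1` otherwise. -/
def gauss (y : ℝ) : ℝ := if y = 0 then 0 else Int.fract y⁻¹

/-- `betaCF x k = β_{k−1}(x) = ∏_{j=0}^{k−1} T^j(x)`; in particular `betaCF x 0 = β_{−1} = 1`. -/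
def betaCF (x : ℝ) (k : ℕ) : ℝ := ∏ j ∈ Finset.range k, gauss^[j] x

/-- `γ_k(x) = β_{k−1}(x) · log(1/T^k(x))`. -/
def gammaCF (x : ℝ) (k : ℕ) : ℝ := betaCF x k * Real.log (gauss^[k] x)⁻¹

theorem gauss_of_pos {y : ℝ} (hy : 0 < y) : gauss y = Int.fract y⁻¹ := by
  simp [gauss, hy.ne']

theorem gauss_mem_Ioo {y : ℝ} (hy : y ∈ Set.Ioo (0 : ℝ) 1) (hirr : Irrational y) :
    gauss y ∈ Set.Ioo (0 : ℝ) 1 := by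
  rw [gauss_of_pos hy.1]
  refine ⟨lt_of_le_of_ne (Int.fract_nonneg _) fun h => ?_, Int.fract_lt_one _⟩
  have h' : (⌊y⁻¹⌋ : ℝ) = y⁻¹ := by
    have := Int.floor_add_fract y⁻¹
    rwa [← h, add_zero] at this
  exact hirr.inv.ne_int _ h'.symm

theorem irrational_gauss {y : ℝ} (hy : 0 < y) (hirr : Irrational y) : Irrational (gauss y) := by
  rw [gauss_of_pos hy, ← Int.self_sub_floor]
  exact hirr.inv.sub_intCast _

theorem mul_gauss_le_half {y : ℝ} (hy : y ∈ Set.Ioo (0 : ℝ) 1) : y * gauss y ≤ 1 / 2 := by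
  rw [gauss_of_pos hy.1]
  have hfloor : (1 : ℝ) ≤ ⌊y⁻¹⌋ := by
    exact_mod_cast Int.le_floor.2 (by exact_mod_cast (one_lt_inv₀ hy.1).2 hy.2 |>.le)
  have hsum := Int.floor_add_fract y⁻¹
  have hlt := Int.fract_lt_one y⁻¹
  have hle : Int.fract y⁻¹ ≤ y⁻¹ / 2 := by linarith
  calc y * Int.fract y⁻¹ ≤ y * (y⁻¹ / 2) := mul_le_mul_of_nonneg_left hle hy.1.le
    _ = 1 / 2 := by field_simp [hy.1.ne']

theorem iterate_gauss_mem {x : ℝ} (hx : x ∈ Set.Ioo (0 : ℝ) 1) (hirr : Irrational x) (k : ℕ) :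
    gauss^[k] x ∈ Set.Ioo (0 : ℝ) 1 ∧ Irrational (gauss^[k] x) := by
  induction k with
  | zero => exact ⟨hx, hirr⟩
  | succ k ih =>
    rw [Function.iterate_succ_apply']
    exact ⟨gauss_mem_Ioo ih.1 ih.2, irrational_gauss ih.1.1 ih.2⟩

theorem betaCF_succ (x : ℝ) (k : ℕ) : betaCF x (k + 1) = betaCF x k * gauss^[k] x :=
  Finset.prod_range_succ _ _

theorem betaCF_pos {x : ℝ} (hx : x ∈ Set.Ioo (0 : ℝ) 1) (hirr : Irrational x) (k : ℕ) :
    0 < betaCF x k :=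
  Finset.prod_pos fun j _ => (iterate_gauss_mem hx hirr j).1.1

theorem antitone_betaCF {x : ℝ} (hx : x ∈ Set.Ioo (0 : ℝ) 1) (hirr : Irrational x) :
    Antitone (betaCF x) :=
  antitone_nat_of_succ_le fun k => by
    rw [betaCF_succ]
    exact mul_le_of_le_one_right (betaCF_pos hx hirr k).le (iterate_gauss_mem hx hirr k).1.2.le

theorem betaCF_sq_le {x : ℝ} (hx : x ∈ Set.Ioo (0 : ℝ) 1) (hirr : Irrational x) (k : ℕ) :
    betaCF x k ^ 2 ≤ 2 * (1 / 2 : ℝ) ^ k := by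
  induction k using Nat.twoStepInduction with
  | zero => norm_num [betaCF]
  | one =>
    have h : betaCF x 1 = x := by simp [betaCF]
    rw [h]
    nlinarith [hx.1, hx.2]
  | more k ih _ =>
    have hstep : betaCF x (k + 2) ≤ betaCF x k * (1 / 2) := by
      rw [betaCF_succ, betaCF_succ, mul_assoc, Function.iterate_succ_apply']
      exact mul_le_mul_of_nonneg_left (mul_gauss_le_half (iterate_gauss_mem hx hirr k).1)
        (betaCF_pos hx hirr k).le
    calc betaCF x (k + 2) ^ 2 ≤ (betaCF x k * (1 / 2)) ^ 2 :=
          pow_le_pow_left₀ (betaCF_pos hx hirr _).le hstep 2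
      _ = betaCF x k ^ 2 * (1 / 4) := by ring
      _ ≤ 2 * (1 / 2 : ℝ) ^ k * (1 / 4) := by gcongr
      _ = 2 * (1 / 2 : ℝ) ^ (k + 2) := by ring

theorem betaCF_sq_mul_abs_sum_le {x : ℝ} (hx : x ∈ Set.Ioo (0 : ℝ) 1) (hirr : Irrational x)
    (k : ℕ) :
    betaCF x k ^ 2 *
      |∑ j ∈ Finset.range k, (-1 : ℝ) ^ j * gauss^[j] x / betaCF x (j + 1) ^ 2| ≤ k := by
  have hk := betaCF_pos hx hirr k
  calc _ ≤ betaCF x k ^ 2 * ∑ j ∈ Finset.range k, (betaCF x k ^ 2)⁻¹ := by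
        refine mul_le_mul_of_nonneg_left ?_ (by positivity)
        refine (Finset.abs_sum_le_sum_abs _ _).trans (Finset.sum_le_sum fun j hj => ?_)
        have ht := (iterate_gauss_mem hx hirr j).1
        have hle : betaCF x k ≤ betaCF x (j + 1) :=
          antitone_betaCF hx hirr (Finset.mem_range.1 hj)
        rw [abs_div, abs_mul, abs_pow, abs_neg, abs_one, one_pow, one_mul, abs_of_pos ht.1,
          abs_of_nonneg (sq_nonneg _), inv_eq_one_div]
        have := ht.2.le
        gcongr
    _ = k := by
        rw [Finset.sum_const, Finset.card_range, nsmul_eq_mul]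
        field_simp

theorem mul_log_inv_mem_Icc {t : ℝ} (ht : t ∈ Set.Ioo (0 : ℝ) 1) :
    t * Real.log t⁻¹ ∈ Set.Icc (0 : ℝ) 1 := by
  have hinv := (one_lt_inv₀ ht.1).2 ht.2
  refine ⟨mul_nonneg ht.1.le (Real.log_nonneg hinv.le), ?_⟩
  calc t * Real.log t⁻¹ ≤ t * t⁻¹ :=
        mul_le_mul_of_nonneg_left (Real.log_le_self (by linarith)) ht.1.le
    _ = 1 := mul_inv_cancel₀ ht.1.ne'

/-- For irrational `x ∈ (0,1)`, the series
`∑ₖ (4(−1)^k β_{k−1}² β_k γ_k ∑_{j<k} (−1)^j T^j/β_j² − β_{k−1}²)` converges absolutely. -/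
theorem summable_partial_sum_series (x : ℝ) (hx : x ∈ Set.Ioo (0 : ℝ) 1)
    (hirr : Irrational x) :
    Summable fun k : ℕ =>
      |4 * (-1 : ℝ) ^ k * betaCF x k ^ 2 * betaCF x (k + 1) * gammaCF x k *
          (∑ j ∈ Finset.range k, (-1 : ℝ) ^ j * gauss^[j] x / betaCF x (j + 1) ^ 2)
        - betaCF x k ^ 2| := by
  have hgeom : Summable fun k : ℕ => (1 / 2 : ℝ) ^ k :=
    summable_geometric_of_lt_one (by norm_num) (by norm_num)
  have hlin : Summable fun k : ℕ => (k : ℝ) * (1 / 2 : ℝ) ^ k := by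
    simpa using summable_pow_mul_geometric_of_norm_lt_one (R := ℝ) 1 (r := 1 / 2) (by norm_num)
  refine Summable.of_nonneg_of_le (fun _ => abs_nonneg _) (fun k => ?_)
    ((hlin.mul_left 8).add (hgeom.mul_left 2))
  set S := ∑ j ∈ Finset.range k, (-1 : ℝ) ^ j * gauss^[j] x / betaCF x (j + 1) ^ 2
  have hS : betaCF x k ^ 2 * |S| ≤ k := betaCF_sq_mul_abs_sum_le hx hirr k
  have hb := betaCF_sq_le hx hirr k
  obtain ⟨hL0, hL1⟩ := mul_log_inv_mem_Icc (iterate_gauss_mem hx hirr k).1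
  have hterm : |4 * (-1 : ℝ) ^ k * betaCF x k ^ 2 * betaCF x (k + 1) * gammaCF x k * S| ≤
      8 * (k * (1 / 2 : ℝ) ^ k) := by
    rw [betaCF_succ, gammaCF]
    calc _ = |(-1 : ℝ) ^ k * (4 * betaCF x k ^ 2 * betaCF x k ^ 2 *
            (gauss^[k] x * Real.log (gauss^[k] x)⁻¹)) * S| := by
          congr 1
          ring
      _ = 4 * betaCF x k ^ 2 * (betaCF x k ^ 2 * |S|) *
            (gauss^[k] x * Real.log (gauss^[k] x)⁻¹) := by
          rw [abs_mul, abs_mul, abs_pow, abs_neg, abs_one, one_pow, one_mul,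
            abs_of_nonneg (mul_nonneg (by positivity) hL0)]
          ring
      _ ≤ 4 * (2 * (1 / 2 : ℝ) ^ k) * k * 1 := by gcongr
      _ = 8 * (k * (1 / 2 : ℝ) ^ k) := by ring
  refine (abs_sub _ _).trans (add_le_add hterm ?_)
  rwa [abs_of_nonneg (sq_nonneg _)]

end
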